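/- arXiv:2302.08530 — 4 statements merged into one kernel-verified Lean document; each statement's English description precedes it below -/
import Mathlib

section
/- Local strong convexity of the negative-entropy Bregman divergence: for all real numbers x, y > 0, V_h(y, x) = y \log(y/x) + x - y \ge (y - x)^2 / (2 \max(x, y)). -/
theorem Real.log_le_half_sub_inv {r : ℝ} (hr : 1 ≤ r) : Real.log r ≤ (r - r⁻¹) / 2 := by
  rw [← Real.sinh_log (by linarith)]
  exact Real.self_le_sinh_iff.2 (Real.log_nonneg hr)

/-- Local strong convexity of the negative-entropy Bregman divergence:
for `x, y > 0`, `y * log (y / x) + x - y ≥ (y - x)^2 / (2 * max x y)`. -/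
theorem negEntropy_bregman_local_strong_convexity (x y : ℝ) (hx : 0 < x) (hy : 0 < y) :
    y * Real.log (y / x) + x - y ≥ (y - x) ^ 2 / (2 * max x y) := by
  rcases le_total x y with h | h
  · rw [max_eq_right h]
    have hlog : 2 * (y - x) / (y + x) ≤ Real.log (y / x) := by
      have := Real.le_log_one_add_of_nonneg (div_nonneg (sub_nonneg.2 h) hx.le)
      convert this using 1
      · field_simp
        ring
      · congr 1
        field_simp
        ring
    have hmul := mul_le_mul_of_nonneg_left hlog hy.le
    have hgap : y * (2 * (y - x) / (y + x)) + x - y - (y - x) ^ 2 / (2 * y) =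
        (y - x) ^ 3 / (2 * y * (y + x)) := by
      field_simp
      ring
    have hpos : 0 ≤ (y - x) ^ 3 / (2 * y * (y + x)) :=
      div_nonneg (pow_nonneg (sub_nonneg.2 h) 3) (by positivity)
    linarith
  · rw [max_eq_left h]
    have hmul := mul_le_mul_of_nonneg_left
      (Real.log_le_half_sub_inv ((one_le_div hy).2 h)) hy.le
    rw [← inv_div y x, Real.log_inv] at hmul
    have heq : y * (((y / x)⁻¹ - (y / x)⁻¹⁻¹) / 2) = x - y - (y - x) ^ 2 / (2 * x) := by
      field_simp
      ring
    linarith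
end

section
/- One-step multiplicative-weights bound for the negative-entropy Bregman divergence: let \lambda, \lambda^* > 0, let g be a real number and \alpha > 0 with \alpha g \ge -1, and let V_h(y, x) = y \log(y/x) - y + x. Then V_h(\lambda^*, \lambda e^{-\alpha g}) \le V_h(\lambda^*, \lambda) - \alpha g (\lambda - \lambda^*) + \alpha^2 g^2 \lambda. -/
/-- Quadratic upper bound for the exponential on `(-∞, 1]`. -/
theorem Real.exp_le_one_add_add_sq_of_le_one {x : ℝ} (hx : x ≤ 1) :
    Real.exp x ≤ 1 + x + x ^ 2 := by
  rcases le_total (-1) x with h | h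
  · linarith [(abs_le.mp (Real.abs_exp_sub_one_sub_id_le (abs_le.mpr ⟨h, hx⟩))).2]
  · have hexp : Real.exp x ≤ 1 := Real.exp_le_one_iff.mpr (by linarith)
    nlinarith

/-- One-step multiplicative-weights bound for the negative-entropy Bregman divergence
`V_h (y, x) = y log (y/x) - y + x`: for `λ, λ* > 0`, `α > 0`, and `α g ≥ -1`,
`V_h (λ*, λ e^{-αg}) ≤ V_h (λ*, λ) - α g (λ - λ*) + α² g² λ`. -/
theorem mw_one_step_bregman_bound (lam lamStar : ℝ) (hlam : 0 < lam) (hlamStar : 0 < lamStar)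
    (g α : ℝ) (hα : 0 < α) (hαg : -1 ≤ α * g)
    (Vh : ℝ → ℝ → ℝ) (hVh : ∀ y x, Vh y x = y * Real.log (y / x) - y + x) :
    Vh lamStar (lam * Real.exp (-α * g)) ≤
      Vh lamStar lam - α * g * (lam - lamStar) + α ^ 2 * g ^ 2 * lam := by
  have hlog : Real.log (lamStar / (lam * Real.exp (-α * g))) =
      Real.log (lamStar / lam) + α * g := by
    rw [← div_div, Real.log_div (div_pos hlamStar hlam).ne' (Real.exp_ne_zero _), Real.log_exp]
    ring
  have hexp : Real.exp (-α * g) ≤ 1 + -α * g + (-α * g) ^ 2 :=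
    Real.exp_le_one_add_add_sq_of_le_one (by linarith)
  rw [hVh, hVh, hlog]
  linarith [mul_le_mul_of_nonneg_left hexp hlam.le]
end

section
/- Finite-time convergence of the min-pacing ODE to the orbit of the optimal dual solution (ROS-binding case): let g^B, g^R : [0, \infty) \to \mathbb{R} be Lipschitz continuous and bounded, suppose g^B crosses the nonnegative axis exactly once, from above, at k_B > 0 (g^B(k) > 0 for 0 \le k < k_B and g^B(k) < 0 for k > k_B), g^R crosses the positive axis exactly once, from above, at k_R > 1 (g^R(k) > 0 for 0 < k < k_R and g^R(k) < 0 for k > k_R), and k_R < k_B. Set \lambda^* = 1/(k_R - 1), \mu^* = 0, k^{\min}(\lambda,\mu) = \min((1+\lambda)/\lambda, 1/\mu), and let \epsilon > 0 be such that: (a) k^{\min}(\lambda,\mu) = (1+\lambda)/\lambda for all (\lambda,\mu) with \max(|\lambda - \lambda^*|, |\mu - \mu^*|) < \epsilon; (b) g^B(k^{\min}(\lambda,\mu)) > 0 on that set; (c) g^R(k^{\min}(\lambda,\mu)) < 0 and g^B(k^{\min}(\lambda,\mu)) < 0 whenever both \lambda < \epsilon and \mu < \epsilon. Then for any solution (\bar\lambda(s),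 \bar\mu(s)) of the ODE system (d/ds) \log \bar\lambda(s) = -g^R(k^{\min}(\bar\lambda(s), \bar\mu(s))), (d/ds) \log \bar\mu(s) = -g^B(k^{\min}(\bar\lambda(s), \bar\mu(s))) with initial condition (\bar\lambda(0), \bar\mu(0)) \notin [0,\epsilon)^2, there exists a finite time \sigma > 0 such that \max(|\bar\lambda(\sigma) - \lambda^*|, |\bar\mu(\sigma) - \mu^*|) < \epsilon/2 and (\bar\lambda(s), \bar\mu(s)) \notin [0,\epsilon)^2 for all s \in [0, \sigma]. -/
open Set

/-- A function that decreases at rate at least `c > 0` whenever it is at or above the level `a`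
is eventually at most `a`. -/
lemma exists_forall_ge_le_of_deriv_le_neg {f f' : ℝ → ℝ} {T a c : ℝ} (hc : 0 < c)
    (hf : ∀ s ≥ T, HasDerivAt f (f' s) s) (hdec : ∀ s ≥ T, a ≤ f s → f' s ≤ -c) :
    ∃ T' ≥ T, ∀ s ≥ T', f s ≤ a := by
  have hcont (t u : ℝ) (ht : T ≤ t) : ContinuousOn f (Icc t u) := fun s hs =>
    (hf s (ht.trans hs.1)).continuousAt.continuousWithinAt
  obtain ⟨t, ht, hta⟩ : ∃ t ≥ T, f t ≤ a := by
    by_contra! h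
    have hbound : ∀ u ≥ T, f u ≤ f T - c / 2 * (u - T) := by
      intro u hu
      refine image_le_of_deriv_right_lt_deriv_boundary (a := T) (b := u) (f' := f')
        (B := fun s => f T - c / 2 * (s - T)) (B' := fun _ => -(c / 2)) (hcont T u le_rfl)
        (fun s hs => (hf s hs.1).hasDerivWithinAt) (by simp) (fun s => ?_) (fun s hs _ => ?_)
        (right_mem_Icc.2 hu)
      · simpa using (((hasDerivAt_id s).sub_const T).const_mul (c / 2)).const_sub (f T)
      · linarith [hdec s hs.1 (h s hs.1).le]
    have hT := h T le_rfl
    have hnonneg : 0 ≤ 2 * (f T - a) / c := by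
      have : 0 ≤ f T - a := by linarith
      positivity
    have hle := hbound (T + 2 * (f T - a) / c) (by linarith)
    have hgt := h (T + 2 * (f T - a) / c) (by linarith)
    have : c / 2 * (T + 2 * (f T - a) / c - T) = f T - a := by field_simp; ring
    linarith
  refine ⟨t, ht, fun u hu => ?_⟩
  refine image_le_of_deriv_right_lt_deriv_boundary (a := t) (b := u) (f' := f')
    (B := fun _ => a) (B' := fun _ => 0) (hcont t u ht)
    (fun s hs => (hf s (le_trans ht hs.1)).hasDerivWithinAt) hta
    (fun s => hasDerivAt_const s a) (fun s hs hsa => ?_) (right_mem_Icc.2 hu)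
  linarith [hdec s (le_trans ht hs.1) hsa.ge]

/-- A continuous positive function on a compact interval is bounded below by a positive constant. -/
lemma exists_pos_forall_Icc_le {g : ℝ → ℝ} {a b : ℝ} (hg : ContinuousOn g (Icc a b))
    (hpos : ∀ k ∈ Icc a b, 0 < g k) : ∃ c > 0, ∀ k ∈ Icc a b, c ≤ g k := by
  rcases (Icc a b).eq_empty_or_nonempty with h | h
  · exact ⟨1, one_pos, by simp [h]⟩
  · obtain ⟨k, hk, hmin⟩ := isCompact_Icc.exists_isMinOn h hg
    exact ⟨g k, hpos k hk, fun u hu => hmin hu⟩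

/-- If both `f` and `g` have nonnegative derivative whenever both are below the level `a`, then
the region where both are below `a` cannot be entered from outside. -/
lemma not_both_lt_of_deriv_nonneg {f g f' g' : ℝ → ℝ} {T a : ℝ}
    (hf : ∀ s ≥ T, HasDerivAt f (f' s) s) (hg : ∀ s ≥ T, HasDerivAt g (g' s) s)
    (hinc : ∀ s ≥ T, f s < a → g s < a → 0 ≤ f' s ∧ 0 ≤ g' s)
    (hT : ¬(f T < a ∧ g T < a)) : ∀ s ≥ T, ¬(f s < a ∧ g s < a) := by
  rintro s hs ⟨hfs, hgs⟩
  have hcf : ContinuousOn f (Icc T s) := fun u hu => (hf u hu.1).continuousAt.continuousWithinAt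
  have hcg : ContinuousOn g (Icc T s) := fun u hu => (hg u hu.1).continuousAt.continuousWithinAt
  have hclosed : IsClosed (Icc T s ∩ (fun u => max (f u) (g u)) ⁻¹' Ici a) :=
    (hcf.sup hcg).preimage_isClosed_of_isClosed isClosed_Icc isClosed_Ici
  have hmem : ∀ u, max (f u) (g u) ∈ Ici a ↔ ¬(f u < a ∧ g u < a) := fun u => by
    rw [mem_Ici, ← max_lt_iff, not_lt]
  obtain ⟨t, ⟨htI, hta⟩, htmax⟩ :=
    (isCompact_Icc.of_isClosed_subset hclosed inter_subset_left).exists_isGreatest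
      ⟨T, left_mem_Icc.2 hs, (hmem T).2 hT⟩
  have hbox : ∀ u ∈ Ioc t s, f u < a ∧ g u < a := by
    intro u hu
    by_contra h
    exact absurd (htmax ⟨⟨htI.1.trans hu.1.le, hu.2⟩, (hmem u).2 h⟩) (not_le.2 hu.1)
  have hsub : Icc t s ⊆ Icc T s := Icc_subset_Icc_left htI.1
  have hderiv : ∀ u ∈ interior (Icc t s), 0 ≤ f' u ∧ 0 ≤ g' u := by
    intro u hu
    rw [interior_Icc] at hu
    have := hbox u ⟨hu.1, hu.2.le⟩
    exact hinc u (htI.1.trans hu.1.le) this.1 this.2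
  have hTu : ∀ u ∈ interior (Icc t s), T ≤ u := fun u hu => (hsub (interior_subset hu)).1
  have hfm : MonotoneOn f (Icc t s) :=
    monotoneOn_of_hasDerivWithinAt_nonneg (convex_Icc t s) (hcf.mono hsub)
      (fun u hu => (hf u (hTu u hu)).hasDerivWithinAt) (fun u hu => (hderiv u hu).1)
  have hgm : MonotoneOn g (Icc t s) :=
    monotoneOn_of_hasDerivWithinAt_nonneg (convex_Icc t s) (hcg.mono hsub)
      (fun u hu => (hg u (hTu u hu)).hasDerivWithinAt) (fun u hu => (hderiv u hu).2)
  have hl := left_mem_Icc.2 htI.2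
  have hr := right_mem_Icc.2 htI.2
  exact (hmem t).1 hta ⟨(hfm hl hr htI.2).trans_lt hfs, (hgm hl hr htI.2).trans_lt hgs⟩

/-- Finite-time convergence of the min-pacing ODE to the orbit of the optimal dual
solution (ROS-binding case `k_R < k_B`): for Lipschitz, bounded expected gradients
`g^B, g^R` with single crossing points `k_B > 0` and `k_R > 1`, optimal duals
`λ* = 1/(k_R - 1)`, `μ* = 0`, and an orbit radius `ε` satisfying conditions (a)–(c),
any solution of the min-pacing ODE started outside `[0, ε)²` reaches the `ε/2`-orbit
of `(λ*, μ*)` in finite time without entering `[0, ε)²` on the way. -/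
theorem min_pacing_ode_reaches_orbit
    (gB gR : ℝ → ℝ)
    (LgB LgR : NNReal)
    (hLipB : LipschitzOnWith LgB gB (Set.Ici 0)) (hLipR : LipschitzOnWith LgR gR (Set.Ici 0))
    (C : ℝ) (hBddB : ∀ k ≥ (0:ℝ), |gB k| ≤ C) (hBddR : ∀ k ≥ (0:ℝ), |gR k| ≤ C)
    (kB kR : ℝ) (hkB : 0 < kB) (hkR : 1 < kR)
    (hBcross_pos : ∀ k, 0 ≤ k → k < kB → 0 < gB k)
    (hBcross_neg : ∀ k, kB < k → gB k < 0)
    (hRcross_pos : ∀ k, 0 < k → k < kR → 0 < gR k)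
    (hRcross_neg : ∀ k, kR < k → gR k < 0)
    (hRB : kR < kB)
    (lamStar muStar : ℝ) (hlamStar : lamStar = 1 / (kR - 1)) (hmuStar : muStar = 0)
    (ε : ℝ) (hε : 0 < ε)
    (hεa : ∀ lam mu : ℝ, 0 < lam → 0 < mu →
      max |lam - lamStar| |mu - muStar| < ε →
      min ((1 + lam) / lam) (1 / mu) = (1 + lam) / lam)
    (hεb : ∀ lam mu : ℝ, 0 < lam → 0 < mu →
      max |lam - lamStar| |mu - muStar| < ε →
      0 < gB (min ((1 + lam) / lam) (1 / mu)))
    (hεc : ∀ lam mu : ℝ, 0 < lam → 0 < mu → lam < ε → mu < ε →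
      gR (min ((1 + lam) / lam) (1 / mu)) < 0 ∧ gB (min ((1 + lam) / lam) (1 / mu)) < 0)
    (lam mu : ℝ → ℝ)
    (hpos : ∀ s ≥ (0:ℝ), 0 < lam s ∧ 0 < mu s)
    (hlamODE : ∀ s ≥ (0:ℝ), HasDerivAt (fun u => Real.log (lam u))
      (-(gR (min ((1 + lam s) / lam s) (1 / mu s)))) s)
    (hmuODE : ∀ s ≥ (0:ℝ), HasDerivAt (fun u => Real.log (mu u))
      (-(gB (min ((1 + lam s) / lam s) (1 / mu s)))) s)
    (hinit : ¬(lam 0 < ε ∧ mu 0 < ε)) :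
    ∃ σ > (0:ℝ), max |lam σ - lamStar| |mu σ - muStar| < ε / 2 ∧
      ∀ s ∈ Set.Icc (0:ℝ) σ, ¬(lam s < ε ∧ mu s < ε) := by
  have hcB : ContinuousOn gB (Ici 0) := hLipB.continuousOn
  have hcR : ContinuousOn gR (Ici 0) := hLipR.continuousOn
  have hlog_lt : ∀ {x a : ℝ}, 0 < x → 0 < a → (Real.log x < Real.log a ↔ x < a) :=
    fun hx ha => Real.log_lt_log_iff hx ha
  have hlog_le : ∀ {x a : ℝ}, 0 < x → 0 < a → (Real.log x ≤ Real.log a ↔ x ≤ a) :=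
    fun hx ha => Real.log_le_log_iff hx ha
  have hbid : ∀ {l : ℝ}, 0 < l → (1 + l) / l = 1 + 1 / l := fun hl => by field_simp; ring
  have hbid_anti : ∀ {l l' : ℝ}, 0 < l → l ≤ l' → (1 + l') / l' ≤ (1 + l) / l := fun hl hll => by
    rw [hbid hl, hbid (hl.trans_le hll)]
    gcongr
  -- the trajectory stays outside the box
  have hout : ∀ s ≥ (0:ℝ), ¬(lam s < ε ∧ mu s < ε) := by
    have h := not_both_lt_of_deriv_nonneg (a := Real.log ε) hlamODE hmuODE
      (fun s hs h1 h2 => by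
        obtain ⟨hl, hm⟩ := hpos s hs
        have := hεc _ _ hl hm ((hlog_lt hl hε).1 h1) ((hlog_lt hm hε).1 h2)
        constructor <;> linarith)
      (by rwa [hlog_lt (hpos 0 le_rfl).1 hε, hlog_lt (hpos 0 le_rfl).2 hε])
    intro s hs
    have := h s hs
    rwa [hlog_lt (hpos s hs).1 hε, hlog_lt (hpos s hs).2 hε] at this
  have hkpos : ∀ s ≥ (0:ℝ), 0 < min ((1 + lam s) / lam s) (1 / mu s) := fun s hs => by
    obtain ⟨hl, hm⟩ := hpos s hs
    exact lt_min (by positivity) (by positivity)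
  have hkle : ∀ s ≥ (0:ℝ), min ((1 + lam s) / lam s) (1 / mu s) ≤ (1 + ε) / ε := by
    intro s hs
    rcases not_and_or.1 (hout s hs) with h | h
    · exact (min_le_left _ _).trans (hbid_anti hε (not_lt.1 h))
    · refine (min_le_right _ _).trans ((one_div_le_one_div_of_le hε (not_lt.1 h)).trans ?_)
      rw [hbid hε]
      linarith
  -- eventually `1 / mu` is at least some level `p` strictly between `kR` and `kB`
  obtain ⟨p, hpR, hpB⟩ := exists_between hRB
  have hp : 0 < p := by linarith
  obtain ⟨c₁, hc₁, hgB₁⟩ := exists_pos_forall_Icc_le (a := 0) (b := p)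
    (hcB.mono Icc_subset_Ici_self) (fun k hk => hBcross_pos k hk.1 (hk.2.trans_lt hpB))
  obtain ⟨T₁, hT₁, hmu₁⟩ := exists_forall_ge_le_of_deriv_le_neg (a := Real.log (1 / p)) hc₁ hmuODE
    (fun s hs h => by
      rw [hlog_le (by positivity) (hpos s hs).2, one_div_le hp (hpos s hs).2] at h
      linarith [hgB₁ _ ⟨(hkpos s hs).le, (min_le_right _ _).trans h⟩])
  replace hmu₁ : ∀ s ≥ T₁, p ≤ 1 / mu s := fun s hs => by
    have hm := (hpos s (hT₁.trans hs)).2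
    have := hmu₁ s hs
    rwa [hlog_le hm (by positivity), le_one_div hm hp] at this
  -- a window around `lamStar` on which the bid multiplier stays below `kB`
  have hkR1 : 0 < kR - 1 := by linarith
  have hkB1 : 0 < kB - 1 := by linarith
  have hstar : 0 < lamStar := by rw [hlamStar]; positivity
  have hlB : 1 / (kB - 1) < lamStar := by
    rw [hlamStar]
    exact one_div_lt_one_div_of_lt hkR1 (by linarith)
  obtain ⟨l, hl, hlstar⟩ := exists_between
    (max_lt hlB (show lamStar - ε / 4 < lamStar by linarith))
  obtain ⟨hlB', hlε⟩ := max_lt_iff.1 hl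
  have hlpos : 0 < l := lt_trans (by positivity) hlB'
  have hlkB : (1 + l) / l < kB := by
    rw [hbid hlpos]
    linarith [(one_div_lt hkB1 hlpos).1 hlB']
  have hlkR : kR < (1 + l) / l := by
    rw [hlamStar] at hlstar
    rw [hbid hlpos]
    linarith [(lt_one_div hlpos hkR1).1 hlstar]
  set r := lamStar + ε / 4 with hr
  have hrpos : 0 < r := by positivity
  have hrkR : (1 + r) / r < kR := by
    have : 1 / (kR - 1) < r := by rw [← hlamStar, hr]; linarith
    rw [hbid hrpos]
    linarith [(one_div_lt hkR1 hrpos).1 this]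
  -- eventually `lam ≤ r`
  obtain ⟨c₂, hc₂, hgR₂⟩ := exists_pos_forall_Icc_le (a := 1) (b := (1 + r) / r)
    (hcR.mono (Icc_subset_Ici_self.trans (Ici_subset_Ici.2 zero_le_one)))
    (fun k hk => hRcross_pos k (by linarith [hk.1]) (hk.2.trans_lt hrkR))
  obtain ⟨T₂, hT₂, hlam₂⟩ := exists_forall_ge_le_of_deriv_le_neg (a := Real.log r) hc₂
    (fun s hs => hlamODE s (hT₁.trans hs)) (fun s hs h => by
      have hls := (hpos s (hT₁.trans hs)).1
      rw [hlog_le hrpos hls] at h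
      have h1 : 1 ≤ min ((1 + lam s) / lam s) (1 / mu s) := by
        refine le_min ?_ (by linarith [hmu₁ s hs])
        rw [hbid hls]
        linarith [one_div_pos.2 hls]
      linarith [hgR₂ _ ⟨h1, (min_le_left _ _).trans (hbid_anti hrpos h)⟩])
  -- eventually `l ≤ lam`
  have hq : kR < min ((1 + l) / l) p := lt_min hlkR hpR
  obtain ⟨c₃, hc₃, hgR₃⟩ := exists_pos_forall_Icc_le (g := fun k => -gR k)
    (a := min ((1 + l) / l) p) (b := (1 + ε) / ε)
    (hcR.mono (Icc_subset_Ici_self.trans (Ici_subset_Ici.2 (by linarith)))).neg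
    (fun k hk => neg_pos.2 (hRcross_neg k (hq.trans_le hk.1)))
  have hT₂0 : 0 ≤ T₂ := le_trans hT₁ hT₂
  obtain ⟨T₃, hT₃, hlam₃⟩ := exists_forall_ge_le_of_deriv_le_neg (a := -Real.log l) hc₃
    (fun s hs => (hlamODE s (hT₂0.trans hs)).neg) (fun s hs h => by
      have hls := (hpos s (hT₂0.trans hs)).1
      simp only [Pi.neg_apply, neg_le_neg_iff] at h
      rw [hlog_le hls hlpos] at h
      have h1 : min ((1 + l) / l) p ≤ min ((1 + lam s) / lam s) (1 / mu s) :=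
        min_le_min (hbid_anti hls h) (hmu₁ s (le_trans hT₂ hs))
      linarith [hgR₃ _ ⟨h1, hkle s (hT₂0.trans hs)⟩])
  have hT₃0 : 0 ≤ T₃ := le_trans hT₂0 hT₃
  replace hlam₃ : ∀ s ≥ T₃, l ≤ lam s := fun s hs => by
    have := hlam₃ s hs
    simp only [Pi.neg_apply, neg_le_neg_iff] at this
    rwa [hlog_le hlpos (hpos s (hT₃0.trans hs)).1] at this
  -- eventually `mu ≤ ε / 4`
  obtain ⟨c₄, hc₄, hgB₄⟩ := exists_pos_forall_Icc_le (a := 0) (b := (1 + l) / l)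
    (hcB.mono Icc_subset_Ici_self) (fun k hk => hBcross_pos k hk.1 (hk.2.trans_lt hlkB))
  obtain ⟨T₄, hT₄, hmu₄⟩ := exists_forall_ge_le_of_deriv_le_neg (a := Real.log (ε / 4)) hc₄
    (fun s hs => hmuODE s (hT₃0.trans hs)) (fun s hs _ => by
      linarith [hgB₄ _ ⟨(hkpos s (hT₃0.trans hs)).le,
        (min_le_left _ _).trans (hbid_anti hlpos (hlam₃ s hs))⟩])
  have hσ : 0 < T₄ + 1 := by linarith
  obtain ⟨hls, hms⟩ := hpos (T₄ + 1) hσ.le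
  have h1 := (hlog_le hls hrpos).1 (hlam₂ (T₄ + 1) (by linarith))
  have h2 := hlam₃ (T₄ + 1) (by linarith)
  have h3 := (hlog_le hms (by positivity)).1 (hmu₄ (T₄ + 1) (by linarith))
  refine ⟨T₄ + 1, hσ, max_lt ?_ ?_, fun s hs => hout s hs.1⟩
  · rw [abs_lt]
    constructor <;> linarith
  · rw [hmuStar, sub_zero, abs_of_pos hms]
    linarith
end

section
/- Truthful bidding optimality under Myerson payments: let x : [0,\infty) \to \mathbb{R} be nondecreasing and locally integrable, and define the payment p(b) = b \cdot x(b) - \int_0^b x(z) dz. Then for every value v \ge 0 and every bid b \ge 0, v \cdot x(v) - p(v) \ge v \cdot x(b) - p(b); that is, bidding one's true value maximizes the quasilinear utility. -/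
/-- Truthful bidding optimality under Myerson payments: if `x` is nondecreasing and
locally integrable on `[0, ∞)` and `p b = b * x b - ∫_0^b x`, then for every value
`v ≥ 0` and bid `b ≥ 0`, `v * x v - p v ≥ v * x b - p b`. -/
theorem truthful_bidding_optimal
    (x : ℝ → ℝ) (hmono : MonotoneOn x (Set.Ici 0))
    (hint : ∀ b ≥ (0:ℝ), IntervalIntegrable x MeasureTheory.volume 0 b)
    (p : ℝ → ℝ) (hp : ∀ b ≥ (0:ℝ), p b = b * x b - ∫ z in (0:ℝ)..b, x z)
    (v : ℝ) (hv : 0 ≤ v) (b : ℝ) (hb : 0 ≤ b) :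
    v * x v - p v ≥ v * x b - p b := by
  have hbv : IntervalIntegrable x MeasureTheory.volume b v := (hint b hb).symm.trans (hint v hv)
  have hsub := intervalIntegral.integral_interval_sub_left (hint v hv) (hint b hb)
  have key : (v - b) * x b ≤ ∫ z in b..v, x z := by
    rcases le_total b v with h | h
    · have := intervalIntegral.integral_mono_on h intervalIntegrable_const hbv
        fun z hz => hmono hb (hb.trans hz.1) hz.1
      simpa using this
    · have := intervalIntegral.integral_mono_on h hbv.symm intervalIntegrable_const
        fun z hz => hmono (hv.trans hz.1) hb hz.2
      rw [intervalIntegral.integral_const, smul_eq_mul] at this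
      rw [intervalIntegral.integral_symm]
      linarith
  rw [hp v hv, hp b hb]
  linarith
end
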